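/- Let n ≥ 1 and let M be a positive C² function on ℝⁿ. There exists a constant C₁ > 0, depending only on n, with the following property: for all closed disjoint subsets E, F ⊂ ℝⁿ with d := dist(E,F) > 0, all t > 0, all f ∈ L²(ℝⁿ,M) supported in E, if u ∈ H¹(ℝⁿ,M) is the weak solution of (I+tL)u = f (i.e. ∫ u v M dx + t ∫ ∇u·∇v M dx = ∫ f v M dx for all v ∈ H¹(ℝⁿ,M)), then ‖u‖_{L²(F,M)} + ‖f - u‖_{L²(F,M)} ≤ 8 e^{-C₁ d/√t} ‖f‖_{L²(E,M)}. -/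

import Mathlib

open MeasureTheory Filter Real Set RealInnerProductSpace

/-- Membership in the weighted Sobolev space `H¹(ℝⁿ, M)`: `f` is differentiable and both
`f` and its gradient are square integrable against the measure `M(x) dx`. -/
def MemH1 {n : ℕ} (M f : EuclideanSpace ℝ (Fin n) → ℝ) : Prop :=
  Differentiable ℝ f ∧ Integrable (fun x => f x ^ 2 * M x) ∧
    Integrable (fun x => ‖gradient f x‖ ^ 2 * M x)

/-- `u` is a weak solution of `(I + tL)u = f`, where `L = -Δ - ∇ ln M · ∇`. -/
def IsWeakSolution {n : ℕ} (M : EuclideanSpace ℝ (Fin n) → ℝ) (t : ℝ)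
    (f u : EuclideanSpace ℝ (Fin n) → ℝ) : Prop :=
  MemH1 M u ∧ ∀ v : EuclideanSpace ℝ (Fin n) → ℝ, MemH1 M v →
    (∫ x, u x * v x * M x) + t * (∫ x, ⟪gradient u x, gradient v x⟫ * M x)
      = ∫ x, f x * v x * M x



lemma exists_smooth_dist {n : ℕ} (S T : Set (EuclideanSpace ℝ (Fin n))) (d : ℝ) (hd : 0 < d)
    (hST : ∀ x ∈ S, ∀ y ∈ T, d ≤ dist x y) :
    ∃ g : (EuclideanSpace ℝ (Fin n)) → ℝ, ContDiff ℝ 1 g ∧ (∀ x, ‖gradient g x‖ ≤ 1) ∧ (∀ x, g x ≤ 2 * d) ∧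
      (∀ x ∈ S, g x ≤ d / 4) ∧ (∀ x ∈ T, 3 * d / 4 ≤ g x) := by
  rcases S.eq_empty_or_nonempty with rfl | hS
  · refine ⟨fun _ => d, contDiff_const, ?_, ?_, ?_, ?_⟩
    · intro x
      simp [gradient]
    · intro x; linarith
    · simp
    · intro x _; linarith
  set h : (EuclideanSpace ℝ (Fin n)) → ℝ := fun x => min (Metric.infDist x S) d with hh
  have hL : LipschitzWith 1 h := (Metric.lipschitz_infDist_pt S).min_const d
  have hc : Continuous h := hL.continuous
  let φ : ContDiffBump (0 : EuclideanSpace ℝ (Fin n)) := ⟨d / 8, d / 4, by positivity, by linarith⟩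
  let g : (EuclideanSpace ℝ (Fin n)) → ℝ := convolution (φ.normed volume) h (ContinuousLinearMap.lsmul ℝ ℝ) volume
  have hgd : ContDiff ℝ 1 g := φ.hasCompactSupport_normed.contDiff_convolution_left _
    φ.contDiff_normed hc.locallyIntegrable
  have hclose : ∀ x, dist (g x) (h x) ≤ d / 4 := by
    intro x
    apply φ.dist_normed_convolution_le hc.aestronglyMeasurable
    intro y hy
    have := hL.dist_le_mul y x
    rw [Metric.mem_ball] at hy
    have h2 : φ.rOut = d / 4 := rfl
    simp at this
    linarith
  have hint : ∀ x, Integrable (fun s => φ.normed volume s * h (x - s)) := by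
    intro x
    refine Continuous.integrable_of_hasCompactSupport ?_ ?_
    · exact φ.continuous_normed.mul (hc.comp (continuous_const.sub continuous_id))
    · exact φ.hasCompactSupport_normed.mul_right
  have hgL : LipschitzWith 1 g := by
    apply LipschitzWith.of_dist_le_mul
    intro x y
    have e : g x - g y = ∫ s, φ.normed volume s * (h (x - s) - h (y - s)) := by
      simp only [mul_sub]
      rw [integral_sub (hint x) (hint y)]
      rfl
    rw [Real.dist_eq, e, ← Real.norm_eq_abs]
    have hb : ‖∫ s, φ.normed volume s * (h (x - s) - h (y - s))‖
        ≤ ∫ s, φ.normed volume s * dist x y := by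
      apply norm_integral_le_of_norm_le
      · exact φ.integrable_normed.mul_const _
      · refine Eventually.of_forall fun s => ?_
        rw [norm_mul, Real.norm_of_nonneg (φ.nonneg_normed s)]
        apply mul_le_mul_of_nonneg_left _ (φ.nonneg_normed s)
        have := hL.dist_le_mul (x - s) (y - s)
        simpa [Real.dist_eq] using this
    rw [integral_mul_const, φ.integral_normed] at hb
    simpa using hb
  refine ⟨g, hgd, ?_, ?_, ?_, ?_⟩
  · intro x
    have := norm_fderiv_le_of_lipschitz ℝ hgL (x₀ := x)
    simpa [gradient] using this
  · intro x
    have h1 := (abs_le.1 (Real.dist_eq _ _ ▸ hclose x)).2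
    have h2 : h x ≤ d := min_le_right _ _
    linarith
  · intro x hx
    have h1 := (abs_le.1 (Real.dist_eq _ _ ▸ hclose x)).2
    have h2 : h x ≤ 0 := (min_le_left _ _).trans (Metric.infDist_zero_of_mem hx).le
    linarith
  · intro x hx
    have h1 := (abs_le.1 (Real.dist_eq _ _ ▸ hclose x)).1
    have h2 : d ≤ h x := by
      refine le_min ?_ le_rfl
      rw [Metric.le_infDist hS]
      intro y hy
      rw [dist_comm]
      exact hST y hy x hx
    linarith

lemma grad_mul_exp {n : ℕ} (g u : (EuclideanSpace ℝ (Fin n)) → ℝ) (c : ℝ) (hg : Differentiable ℝ g)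
    (hu : Differentiable ℝ u) (x : EuclideanSpace ℝ (Fin n)) :
    gradient (fun y => exp (c * g y) * u y) x
      = exp (c * g x) • gradient u x + (u x * (c * exp (c * g x))) • gradient g x := by
  have h1 : HasFDerivAt (fun y => exp (c * g y)) (exp (c * g x) • (c • fderiv ℝ g x)) x :=
    ((hg x).hasFDerivAt.const_mul c).exp
  have h2 := h1.mul (hu x).hasFDerivAt
  have h3 : fderiv ℝ (fun y => exp (c * g y) * u y) x = _ := h2.fderiv
  unfold gradient
  rw [h3]
  simp only [map_add, map_smul, smul_smul]
  congr 2
  ring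

lemma measurable_grad {n : ℕ} (u : (EuclideanSpace ℝ (Fin n)) → ℝ) : Measurable (gradient u) := by
  unfold gradient
  exact (LinearIsometryEquiv.continuous _).measurable.comp (measurable_fderiv ℝ u)

theorem gaffney_off_diagonal (n : ℕ) (hn : 1 ≤ n) :
    ∃ C₁ > (0:ℝ), ∀ M : EuclideanSpace ℝ (Fin n) → ℝ,
      (∀ x, 0 < M x) → ContDiff ℝ 2 M →
      ∀ S T : Set (EuclideanSpace ℝ (Fin n)),
        IsClosed S → IsClosed T → Disjoint S T →
      ∀ d : ℝ, 0 < d → (∀ x ∈ S, ∀ y ∈ T, d ≤ dist x y) →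
      ∀ t : ℝ, 0 < t →
      ∀ f : EuclideanSpace ℝ (Fin n) → ℝ,
        AEStronglyMeasurable f volume →
        Integrable (fun x => f x ^ 2 * M x) →
        Function.support f ⊆ S →
      ∀ u : EuclideanSpace ℝ (Fin n) → ℝ, IsWeakSolution M t f u →
        Real.sqrt (∫ x in T, u x ^ 2 * M x)
          + Real.sqrt (∫ x in T, (f x - u x) ^ 2 * M x)
          ≤ 8 * Real.exp (-C₁ * d / Real.sqrt t)
            * Real.sqrt (∫ x in S, f x ^ 2 * M x) := by
  refine ⟨1 / 4, by norm_num, ?_⟩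
  intro M hM hMC S T hS hT hdisj d hd hST t ht f hfm hfi hfs u hu
  obtain ⟨⟨hud, hui, hugi⟩, hw⟩ := hu
  obtain ⟨g, hgC, hg1, hgb, hgS, hgT⟩ := exists_smooth_dist S T d hd hST
  have hgd : Differentiable ℝ g := hgC.differentiable (by norm_num)
  have hMc : Continuous M := hMC.continuous
  set r := Real.sqrt t with hr
  have hr0 : 0 < r := Real.sqrt_pos.2 ht
  have hrt : r ^ 2 = t := Real.sq_sqrt ht.le
  set c := r⁻¹ with hcdef
  have hc0 : 0 < c := inv_pos.2 hr0
  have hrc : r * c = 1 := mul_inv_cancel₀ hr0.ne'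
  set w : (EuclideanSpace ℝ (Fin n)) → ℝ := fun x => exp (c * g x) with hwdef
  have hw0 : ∀ x, 0 < w x := fun x => exp_pos _
  set B := exp (c * (2 * d)) with hB
  have hB0 : 0 < B := exp_pos _
  have hwB : ∀ x, w x ≤ B := fun x =>
    exp_le_exp.2 (mul_le_mul_of_nonneg_left (hgb x) hc0.le)
  have hwc : Continuous w := Real.continuous_exp.comp (continuous_const.mul hgC.continuous)
  have huc : Continuous u := hud.continuous
  have hgv : ∀ x, gradient (fun y => w y * u y) x
      = w x • gradient u x + (u x * (c * w x)) • gradient g x :=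
    grad_mul_exp g u c hgd hud
  have hmu := measurable_grad u
  have hmv := measurable_grad (fun y => w y * u y)
  -- pointwise bound on the gradient of v
  have hgvn : ∀ x, ‖gradient (fun y => w y * u y) x‖ ^ 2
      ≤ 2 * B ^ 2 * ‖gradient u x‖ ^ 2 + 2 * (c * B) ^ 2 * u x ^ 2 := by
    intro x
    rw [hgv]
    have h1 : ‖w x • gradient u x + (u x * (c * w x)) • gradient g x‖
        ≤ B * ‖gradient u x‖ + c * B * |u x| := by
      refine (norm_add_le _ _).trans ?_
      rw [norm_smul, norm_smul, norm_mul, norm_mul, Real.norm_of_nonneg (hw0 x).le,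
        Real.norm_of_nonneg hc0.le, Real.norm_eq_abs]
      have a1 := mul_le_mul_of_nonneg_right (hwB x) (norm_nonneg (gradient u x))
      have a2 : |u x| * (c * w x) * ‖gradient g x‖ ≤ |u x| * (c * w x) * 1 :=
        mul_le_mul_of_nonneg_left (hg1 x)
          (mul_nonneg (abs_nonneg _) (mul_nonneg hc0.le (hw0 x).le))
      have a3 : |u x| * (c * w x) ≤ |u x| * (c * B) :=
        mul_le_mul_of_nonneg_left (mul_le_mul_of_nonneg_left (hwB x) hc0.le) (abs_nonneg _)
      linarith
    have h2 := pow_le_pow_left₀ (norm_nonneg _) h1 2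
    have h3 := sq_nonneg (B * ‖gradient u x‖ - c * B * |u x|)
    have h4 : |u x| ^ 2 = u x ^ 2 := sq_abs _
    nlinarith
  have hbd : ∀ h : (EuclideanSpace ℝ (Fin n)) → ℝ, Integrable h → Integrable (fun x => w x * h x) := by
    intro h hh
    refine (hh.norm.const_mul B).mono' (hwc.aestronglyMeasurable.mul hh.1) ?_
    refine Eventually.of_forall fun x => ?_
    rw [norm_mul, Real.norm_of_nonneg (hw0 x).le]
    exact mul_le_mul_of_nonneg_right (hwB x) (norm_nonneg _)
  have hwu : Integrable (fun x => w x * (u x ^ 2 * M x)) := hbd _ hui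
  have hwf : Integrable (fun x => w x * (f x ^ 2 * M x)) := hbd _ hfi
  have hvi : Integrable (fun x => ‖gradient (fun y => w y * u y) x‖ ^ 2 * M x) := by
    refine ((hugi.const_mul (2 * B ^ 2)).add (hui.const_mul (2 * (c * B) ^ 2))).mono'
      ((hmv.norm.pow_const 2).mul hMc.measurable).aestronglyMeasurable ?_
    refine Eventually.of_forall fun x => ?_
    rw [Real.norm_of_nonneg (mul_nonneg (sq_nonneg _) (hM x).le)]
    have := mul_le_mul_of_nonneg_right (hgvn x) (hM x).le
    simp only [Pi.add_apply]
    linarith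
  have hvH : MemH1 M (fun y => w y * u y) := by
    refine ⟨?_, ?_, hvi⟩
    · exact ((hgd.const_mul c).exp).mul hud
    · have := hbd _ hwu
      refine this.congr (Eventually.of_forall fun x => ?_)
      simp only; ring
  have key := hw _ hvH
  have I1 : Integrable (fun x => u x * (w x * u x) * M x) := by
    refine hwu.congr (Eventually.of_forall fun x => ?_)
    simp only; ring
  have I2 : Integrable (fun x => ⟪gradient u x, gradient (fun y => w y * u y) x⟫ * M x) := by
    refine (hugi.add hvi).mono'
      ((hmu.inner hmv).mul hMc.measurable).aestronglyMeasurable ?_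
    refine Eventually.of_forall fun x => ?_
    rw [norm_mul, Real.norm_of_nonneg (hM x).le]
    simp only [Pi.add_apply]
    rw [← add_mul]
    apply mul_le_mul_of_nonneg_right _ (hM x).le
    have h1 := norm_inner_le_norm (𝕜 := ℝ) (gradient u x) (gradient (fun y => w y * u y) x)
    have h2 := sq_nonneg (‖gradient u x‖ - ‖gradient (fun y => w y * u y) x‖)
    have h3 := sq_nonneg (‖gradient u x‖ + ‖gradient (fun y => w y * u y) x‖)
    nlinarith
  have I3 : Integrable (fun x => f x * (w x * u x) * M x) := by
    refine (hwu.add hwf).mono'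
      ((hfm.mul (hwc.mul huc).aestronglyMeasurable).mul hMc.aestronglyMeasurable) ?_
    refine Eventually.of_forall fun x => ?_
    have hp : 0 ≤ w x * M x := mul_nonneg (hw0 x).le (hM x).le
    have e : f x * (w x * u x) * M x = (w x * M x) * (f x * u x) := by ring
    rw [e, norm_mul, Real.norm_of_nonneg hp, Real.norm_eq_abs]
    have h1 : |f x * u x| ≤ u x ^ 2 + f x ^ 2 := by
      rw [abs_le]
      constructor <;> nlinarith [sq_nonneg (f x + u x), sq_nonneg (f x - u x)]
    have := mul_le_mul_of_nonneg_left h1 hp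
    simp only [Pi.add_apply]
    linarith
  have hpt : ∀ x, (1 / 2) * (w x * (u x ^ 2 * M x)) - w x * (f x ^ 2 * M x)
      ≤ u x * (w x * u x) * M x
        + t * (⟪gradient u x, gradient (fun y => w y * u y) x⟫ * M x)
        - f x * (w x * u x) * M x := by
    intro x
    rw [hgv, inner_add_right, inner_smul_right, inner_smul_right, real_inner_self_eq_norm_sq]
    set p := ‖gradient u x‖ with hp
    set q := ⟪gradient u x, gradient g x⟫ with hq
    have hqp : |q| ≤ p := by
      have h1 := abs_real_inner_le_norm (gradient u x) (gradient g x)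
      have h2 := mul_le_mul_of_nonneg_left (hg1 x) (norm_nonneg (gradient u x))
      rw [mul_one] at h2
      exact h1.trans h2
    have hq2 : q ^ 2 ≤ p ^ 2 := sq_le_sq' (abs_le.1 hqp).1 (abs_le.1 hqp).2
    have e1 : t * c = r := by rw [← hrt]; linear_combination r * hrc
    have hP : 0 ≤ w x * M x := mul_nonneg (hw0 x).le (hM x).le
    have hmain : (1 / 2) * u x ^ 2 - f x ^ 2
        ≤ u x ^ 2 + (t * p ^ 2 + r * (u x * q)) - f x * u x := by
      have h5 : r ^ 2 * q ^ 2 ≤ t * p ^ 2 := by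
        rw [hrt]; exact mul_le_mul_of_nonneg_left hq2 ht.le
      nlinarith [sq_nonneg (r * q + u x / 2), sq_nonneg (f x - u x / 2)]
    have := mul_le_mul_of_nonneg_left hmain hP
    have e2 : t * ((w x * p ^ 2 + u x * (c * w x) * q) * M x)
        = (w x * M x) * (t * p ^ 2 + r * (u x * q)) := by rw [← e1]; ring
    rw [e2]
    linarith
  have hint := integral_mono ((hwu.const_mul (1 / 2)).sub hwf)
    ((I1.add (I2.const_mul t)).sub I3) hpt
  rw [integral_sub' (hwu.const_mul (1 / 2)) hwf, integral_sub' (I1.add (I2.const_mul t)) I3,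
    integral_add' I1 (I2.const_mul t), integral_const_mul, integral_const_mul, key,
    sub_self] at hint
  have hfz : ∀ x, x ∉ S → f x = 0 := fun x hx => by
    by_contra h; exact hx (hfs h)
  have hfS : ∫ x in S, f x ^ 2 * M x = ∫ x, f x ^ 2 * M x :=
    setIntegral_eq_integral_of_forall_compl_eq_zero fun x hx => by simp [hfz x hx]
  have hJ : ∫ x, w x * (f x ^ 2 * M x) ≤ exp (c * (d / 4)) * ∫ x, f x ^ 2 * M x := by
    rw [← integral_const_mul]
    refine integral_mono hwf (hfi.const_mul _) fun x => ?_
    by_cases hx : x ∈ S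
    · exact mul_le_mul_of_nonneg_right
        (exp_le_exp.2 (mul_le_mul_of_nonneg_left (hgS x hx) hc0.le))
        (mul_nonneg (sq_nonneg _) (hM x).le)
    · simp [hfz x hx]
  have hK : exp (c * (3 * d / 4)) * ∫ x in T, u x ^ 2 * M x ≤ ∫ x, w x * (u x ^ 2 * M x) := by
    rw [← integral_const_mul]
    refine (setIntegral_mono_on (hui.const_mul _).integrableOn hwu.integrableOn
      hT.measurableSet fun x hx => ?_).trans
      (setIntegral_le_integral hwu (Eventually.of_forall fun x => ?_))
    · exact mul_le_mul_of_nonneg_right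
        (exp_le_exp.2 (mul_le_mul_of_nonneg_left (hgT x hx) hc0.le))
        (mul_nonneg (sq_nonneg _) (hM x).le)
    · exact mul_nonneg (hw0 x).le (mul_nonneg (sq_nonneg _) (hM x).le)
  have hT2 : ∫ x in T, (f x - u x) ^ 2 * M x = ∫ x in T, u x ^ 2 * M x := by
    refine setIntegral_congr_fun hT.measurableSet fun x hx => ?_
    have : f x = 0 := hfz x fun h => Set.disjoint_left.1 hdisj h hx
    simp [this]
  rw [hT2, hfS]
  set I := ∫ x, f x ^ 2 * M x with hI
  set U := ∫ x in T, u x ^ 2 * M x with hU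
  have hI0 : 0 ≤ I := integral_nonneg fun x => mul_nonneg (sq_nonneg _) (hM x).le
  set a := exp (-(1 / 4) * d / r) with ha
  have ha0 : 0 < a := exp_pos _
  have hfin : U ≤ (4 * a * Real.sqrt I) ^ 2 := by
    have e1 : exp (c * (d / 4)) = a ^ 2 * exp (c * (3 * d / 4)) := by
      rw [ha, ← Real.exp_nat_mul, ← Real.exp_add]
      congr 1
      rw [hcdef]
      push_cast
      field_simp
      ring
    have h0 : exp (c * (3 * d / 4)) * U ≤ exp (c * (3 * d / 4)) * (2 * a ^ 2 * I) := by
      rw [e1] at hJ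
      linarith
    have h1 : U ≤ 2 * a ^ 2 * I := le_of_mul_le_mul_left h0 (exp_pos _)
    rw [mul_pow, Real.sq_sqrt hI0]
    have : 0 ≤ a ^ 2 * I := by positivity
    nlinarith
  have := Real.sqrt_le_sqrt hfin
  rw [Real.sqrt_sq (by positivity)] at this
  linarith
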